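/- arXiv:1602.01080 — 5 statements merged into one kernel-verified Lean document; each statement's English description precedes it below -/
import Mathlib

section
/- If u_old ≠ 0, then the extended-domain linear system in unknowns u_1,…,u_N given by (w/γ)·u_1 = 0; (w/γ)·u_2 = u_old/τ; (w/γ)·(u_j − u_{j−1}) = 0 for j = 3,…,N−2; (1/τ)·u_{N−1} + (w/γ)·(u_{N−1} − u_{N−2}) = 0; and −(w/γ)·u_{N−1} = 0 has no solution in ℝ^N; in particular its coefficient matrix is not invertible. -/
/-- The extended-domain finite-volume system for one-dimensional advection with
speed `w` over one time step of size `τ`, where the old interface lies in the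
interior of cell `e 2` and the new interface in the interior of cell `e (N−1)`:
`(w/γ)·u 1 = 0`; `(w/γ)·u 2 = uold/τ`;
`(w/γ)·(u j − u (j−1)) = 0` for `j = 3, …, N−2`;
`(1/τ)·u (N−1) + (w/γ)·(u (N−1) − u (N−2)) = 0`; `−(w/γ)·u (N−1) = 0`. -/
def ExtendedSystem (N : ℕ) (w τ γ uold : ℝ) (u : ℕ → ℝ) : Prop :=
  (w / γ) * u 1 = 0 ∧
  (w / γ) * u 2 = uold / τ ∧
  (∀ j : ℕ, 3 ≤ j → j ≤ N - 2 → (w / γ) * (u j - u (j - 1)) = 0) ∧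
  (1 / τ) * u (N - 1) + (w / γ) * (u (N - 1) - u (N - 2)) = 0 ∧
  -((w / γ) * u (N - 1)) = 0

/-- The coefficient matrix of the extended-domain system; row `i` of the matrix
(for `i : Fin N`) corresponds to the equation for the cell with 1-based index
`i + 1`, and column `j` to the unknown `u (j + 1)`. -/
noncomputable def ExtendedMatrix (N : ℕ) (w τ γ : ℝ) : Matrix (Fin N) (Fin N) ℝ :=
  fun i j =>
    if i.val = 0 then (if j.val = 0 then w / γ else 0)
    else if i.val = 1 then (if j.val = 1 then w / γ else 0)
    else if i.val ≤ N - 3 then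
      (if j.val = i.val then w / γ else if j.val = i.val - 1 then -(w / γ) else 0)
    else if i.val = N - 2 then
      (if j.val = N - 2 then 1 / τ + w / γ else if j.val = N - 3 then -(w / γ) else 0)
    else (if j.val = N - 2 then -(w / γ) else 0)

/-- The last unknown of the extended-domain system appears in no equation. -/
lemma extendedMatrix_apply_last {N : ℕ} (hN : 5 ≤ N) (w τ γ : ℝ) (i j : Fin N)
    (hj : j.val = N - 1) : ExtendedMatrix N w τ γ i j = 0 := by
  have hi := i.isLt
  unfold ExtendedMatrix
  split_ifs <;> first | rfl | omega

/-- In a solution, the value in cell `e 2` is transported unchanged through cell `e (N−2)`. -/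
lemma ExtendedSystem.eq_apply_two {N : ℕ} {w τ γ uold : ℝ} {u : ℕ → ℝ}
    (h : ExtendedSystem N w τ γ uold u) (hc : w / γ ≠ 0) {j : ℕ} (hj : 2 ≤ j)
    (hjN : j ≤ N - 2) : u j = u 2 := by
  induction j, hj using Nat.le_induction with
  | base => rfl
  | succ k hk ih =>
    have hstep := h.2.2.1 (k + 1) (by omega) hjN
    rw [Nat.add_sub_cancel] at hstep
    have hdiff := (mul_eq_zero.mp hstep).resolve_left hc
    rw [sub_eq_zero.mp hdiff, ih (by omega)]

/-- If `uold ≠ 0`, the extended-domain system has no solution in `ℝ^N`;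
in particular its coefficient matrix is not invertible. -/
theorem extended_system_no_solution
    (N : ℕ) (hN : 5 ≤ N) (w τ γ uold : ℝ)
    (hw : 0 < w) (hτ : 0 < τ) (hγ : 0 < γ) (huold : uold ≠ 0) :
    (¬ ∃ u : ℕ → ℝ, ExtendedSystem N w τ γ uold u) ∧
    ¬ IsUnit (ExtendedMatrix N w τ γ) := by
  have hc : w / γ ≠ 0 := (div_pos hw hγ).ne'
  constructor
  · rintro ⟨u, h⟩
    have htransport := h.eq_apply_two hc (show 2 ≤ N - 2 by omega) le_rfl
    obtain ⟨-, hinflow, -, hinterface, houtflow⟩ := h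
    have hlast : u (N - 1) = 0 :=
      (mul_eq_zero.mp (neg_eq_zero.mp houtflow)).resolve_left hc
    rw [hlast, htransport] at hinterface
    have hzero : uold / τ = 0 := by linarith
    exact div_ne_zero huold hτ.ne' hzero
  · rw [Matrix.isUnit_iff_isUnit_det,
      Matrix.det_eq_zero_of_column_eq_zero ⟨N - 1, by omega⟩
        (fun i => extendedMatrix_apply_last hN w τ γ i _ rfl)]
    exact not_isUnit_zero
end

section
/- If u_old = 0, then the solution set of the extended-domain linear system (w/γ)·u_1 = 0; (w/γ)·u_2 = u_old/τ; (w/γ)·(u_j − u_{j−1}) = 0 for j = 3,…,N−2; (1/τ)·u_{N−1} + (w/γ)·(u_{N−1} − u_{N−2}) = 0; −(w/γ)·u_{N−1} = 0 is exactly { (0, 0, …, 0, c) : c ∈ ℝ }; in particular the system does not have a unique solution, i.e., it is underdetermined. -/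
theorem extendedSystem_zero_iff {N : ℕ} (hN : 5 ≤ N) {w τ γ : ℝ} (hw : w ≠ 0) (hγ : γ ≠ 0)
    (u : ℕ → ℝ) :
    ExtendedSystem N w τ γ 0 u ↔ ∀ j : ℕ, 1 ≤ j → j ≤ N - 1 → u j = 0 := by
  have hc : w / γ ≠ 0 := div_ne_zero hw hγ
  constructor
  · rintro ⟨h1, h2, hstep, -, hlast⟩
    have hu1 : u 1 = 0 := (mul_eq_zero_iff_left hc).mp h1
    have hu2 : u 2 = 0 := (mul_eq_zero_iff_left hc).mp (by simpa using h2)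
    have hlast' : u (N - 1) = 0 := (mul_eq_zero_iff_left hc).mp (neg_eq_zero.mp hlast)
    have hmid : ∀ j, 2 ≤ j → j ≤ N - 2 → u j = 0 := by
      intro j hj
      induction j, hj using Nat.le_induction with
      | base => exact fun _ => hu2
      | succ k hk ih =>
        intro hkN
        have h := (mul_eq_zero_iff_left hc).mp (hstep (k + 1) (by omega) hkN)
        rw [Nat.add_sub_cancel, ih (by omega), sub_zero] at h
        exact h
    intro j hj hjN
    obtain rfl | rfl | ⟨hj2, hjN2⟩ : j = 1 ∨ j = N - 1 ∨ (2 ≤ j ∧ j ≤ N - 2) := by omega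
    · exact hu1
    · exact hlast'
    · exact hmid j hj2 hjN2
  · intro h
    refine ⟨?_, ?_, fun j hj hjN => ?_, ?_, ?_⟩
    · rw [h 1 (by omega) (by omega), mul_zero]
    · rw [h 2 (by omega) (by omega), mul_zero, zero_div]
    · rw [h j (by omega) (by omega), h (j - 1) (by omega) (by omega), sub_zero, mul_zero]
    · rw [h (N - 1) (by omega) (by omega), h (N - 2) (by omega) (by omega)]
      ring
    · rw [h (N - 1) (by omega) (by omega), mul_zero, neg_zero]

/-- If `uold = 0`, the solutions of the extended-domain system are exactly the
vectors `(0, 0, …, 0, c)` with `c ∈ ℝ` arbitrary: `u` solves the system iff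
`u j = 0` for `j = 1, …, N−1`, while `u N` is unconstrained. In particular the
system does not have a unique solution, i.e. it is underdetermined. -/
theorem extended_system_underdetermined
    (N : ℕ) (hN : 5 ≤ N) (w τ γ uold : ℝ)
    (hw : 0 < w) (hτ : 0 < τ) (hγ : 0 < γ) (huold : uold = 0) :
    (∀ u : ℕ → ℝ, ExtendedSystem N w τ γ uold u ↔
      (∀ j : ℕ, 1 ≤ j → j ≤ N - 1 → u j = 0)) ∧
    (∃ u v : ℕ → ℝ, ExtendedSystem N w τ γ uold u ∧ ExtendedSystem N w τ γ uold v ∧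
      u N ≠ v N) := by
  subst huold
  have hiff := extendedSystem_zero_iff (τ := τ) hN hw.ne' hγ.ne'
  refine ⟨hiff, 0, Pi.single N 1, (hiff _).mpr fun _ _ _ => rfl,
    (hiff _).mpr fun j _ hj => Pi.single_eq_of_ne (by omega) _, ?_⟩
  simp
end

section
/- Let (u_1(ε),…,u_N(ε)) denote, for each ε > 0, the unique solution of the regularized extended-domain system. Then u_1(ε) = 0 for every ε > 0, and as ε → 0⁺ one has u_j(ε) → (γ/(τ·w))·u_old for each j with 2 ≤ j ≤ N−2, and u_{N−1}(ε) → (γ/(τ·w + γ))·u_old. -/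
open Filter

/-- The regularized extended-domain finite-volume system, obtained by adding a
mass term `ε·u j` to each equation of the extended-domain system:
`ε·u 1 + (w/γ)·u 1 = 0`; `ε·u 2 + (w/γ)·u 2 = uold/τ`;
`ε·u j + (w/γ)·(u j − u (j−1)) = 0` for `j = 3, …, N−2`;
`ε·u (N−1) + (1/τ)·u (N−1) + (w/γ)·(u (N−1) − u (N−2)) = 0`;
`ε·u N − (w/γ)·u (N−1) = 0`. -/
def RegularizedSystem (N : ℕ) (w τ γ uold ε : ℝ) (u : ℕ → ℝ) : Prop :=
  ε * u 1 + (w / γ) * u 1 = 0 ∧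
  ε * u 2 + (w / γ) * u 2 = uold / τ ∧
  (∀ j : ℕ, 3 ≤ j → j ≤ N - 2 → ε * u j + (w / γ) * (u j - u (j - 1)) = 0) ∧
  ε * u (N - 1) + (1 / τ) * u (N - 1) + (w / γ) * (u (N - 1) - u (N - 2)) = 0 ∧
  ε * u N - (w / γ) * u (N - 1) = 0

/-- If `(ε + c) * f ε = g ε` for every `ε > 0`, where `c ≠ 0` and `g` tends to `L` as `ε → 0⁺`,
then `f` tends to `L / c`. -/
theorem tendsto_div_of_add_mul_eq {c L : ℝ} (hc : c ≠ 0) {f g : ℝ → ℝ}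
    (hfg : ∀ ε : ℝ, 0 < ε → (ε + c) * f ε = g ε)
    (hg : Tendsto g (nhdsWithin 0 (Set.Ioi 0)) (nhds L)) :
    Tendsto f (nhdsWithin 0 (Set.Ioi 0)) (nhds (L / c)) := by
  have hadd : Tendsto (fun ε : ℝ => ε + c) (nhdsWithin 0 (Set.Ioi 0)) (nhds c) := by
    have h : Tendsto (fun ε : ℝ => ε + c) (nhds 0) (nhds (0 + c)) :=
      tendsto_id.add tendsto_const_nhds
    rw [zero_add] at h
    exact h.mono_left nhdsWithin_le_nhds
  refine (hg.div hadd hc).congr' ?_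
  filter_upwards [self_mem_nhdsWithin, hadd.eventually_ne hc] with ε hε hne
  rw [Pi.div_apply, div_eq_iff hne, ← hfg ε hε, mul_comm]

/-- If `U ε` solves the regularized extended-domain system for every `ε > 0`,
then `U ε 1 = 0` for every `ε > 0`, and as `ε → 0⁺` one has
`U ε j → (γ/(τ·w))·uold` for `2 ≤ j ≤ N − 2` and
`U ε (N−1) → (γ/(τ·w + γ))·uold`. -/
theorem regularized_system_limit_values
    (N : ℕ) (hN : 5 ≤ N) (w τ γ uold : ℝ)
    (hw : 0 < w) (hτ : 0 < τ) (hγ : 0 < γ)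
    (U : ℝ → ℕ → ℝ)
    (hU : ∀ ε : ℝ, 0 < ε → RegularizedSystem N w τ γ uold ε (U ε)) :
    (∀ ε : ℝ, 0 < ε → U ε 1 = 0) ∧
    (∀ j : ℕ, 2 ≤ j → j ≤ N - 2 →
      Tendsto (fun ε : ℝ => U ε j) (nhdsWithin 0 (Set.Ioi 0))
        (nhds ((γ / (τ * w)) * uold))) ∧
    Tendsto (fun ε : ℝ => U ε (N - 1)) (nhdsWithin 0 (Set.Ioi 0))
      (nhds ((γ / (τ * w + γ)) * uold)) := by
  have hk : 0 < w / γ := div_pos hw hγ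
  have hbulk : ∀ j : ℕ, 2 ≤ j → j ≤ N - 2 →
      Tendsto (fun ε : ℝ => U ε j) (nhdsWithin 0 (Set.Ioi 0))
        (nhds ((γ / (τ * w)) * uold)) := by
    intro j hj
    induction j, hj using Nat.le_induction with
    | base =>
      intro _
      have h := tendsto_div_of_add_mul_eq hk.ne' (f := fun ε => U ε 2)
        (g := fun _ => uold / τ)
        (fun ε hε => by linear_combination (hU ε hε).2.1) tendsto_const_nhds
      convert h using 2
      field_simp
    | succ j hj ih =>
      intro hjN
      have h := tendsto_div_of_add_mul_eq hk.ne' (f := fun ε => U ε (j + 1))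
        (g := fun ε => w / γ * U ε j)
        (fun ε hε => by
          have := (hU ε hε).2.2.1 (j + 1) (by omega) hjN
          rw [Nat.add_sub_cancel] at this
          linear_combination this)
        ((ih (by omega)).const_mul (w / γ))
      rwa [mul_div_cancel_left₀ _ hk.ne'] at h
  refine ⟨fun ε hε => ?_, hbulk, ?_⟩
  · have h : (ε + w / γ) * U ε 1 = 0 := by linear_combination (hU ε hε).1
    exact (mul_eq_zero.mp h).resolve_left (add_pos hε hk).ne'
  · have hc : 0 < 1 / τ + w / γ := by positivity
    have h := tendsto_div_of_add_mul_eq hc.ne' (f := fun ε => U ε (N - 1))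
      (g := fun ε => w / γ * U ε (N - 2))
      (fun ε hε => by linear_combination (hU ε hε).2.2.2.1)
      ((hbulk (N - 2) (by omega) le_rfl).const_mul (w / γ))
    convert h using 2
    field_simp
    ring
end

section
/- Let (u_1(ε),…,u_N(ε)) denote, for each ε > 0, the unique solution of the regularized extended-domain system. Then ε·u_N(ε) → (w·u_old)/(τ·w + γ) as ε → 0⁺; in particular, if u_old > 0 then u_N(ε) → +∞ as ε → 0⁺, i.e., the value on the cell beyond the new interface diverges in the regularization limit. -/
open Filter

/-- The value on the last cell of a solution of the regularized system, in closed form. -/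
theorem RegularizedSystem.mul_last_eq {m : ℕ} {w τ γ uold ε : ℝ} {u : ℕ → ℝ}
    (hw : 0 < w) (hτ : 0 < τ) (hγ : 0 < γ) (hε : 0 < ε)
    (h : RegularizedSystem (m + 4) w τ γ uold ε u) :
    ε * u (m + 4) = w / γ * (w / γ * ((w / γ / (ε + w / γ)) ^ m *
      (uold / τ / (ε + w / γ))) / (ε + 1 / τ + w / γ)) := by
  obtain ⟨-, h_two, h_mid, h_interface, h_last⟩ := h
  have ha : 0 < w / γ := div_pos hw hγ
  have hb : 0 < 1 / τ := one_div_pos.mpr hτ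
  generalize w / γ = a at *
  generalize 1 / τ = b at *
  have geom : ∀ k ≤ m, u (k + 2) = (a / (ε + a)) ^ k * (uold / τ / (ε + a)) := by
    intro k hk
    induction k with
    | zero =>
      rw [pow_zero, one_mul, eq_div_iff (by positivity)]
      linarith
    | succ k ih =>
      have hs : ε * u (k + 3) + a * (u (k + 3) - u (k + 2)) = 0 :=
        h_mid (k + 3) (by omega) (by omega)
      rw [pow_succ', mul_assoc, ← ih (by omega), div_mul_eq_mul_div,
        eq_div_iff (by positivity)]
      linarith
  change ε * u (m + 3) + b * u (m + 3) + a * (u (m + 3) - u (m + 2)) = 0 at h_interface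
  change ε * u (m + 4) - a * u (m + 3) = 0 at h_last
  have hu : u (m + 3) = a * u (m + 2) / (ε + b + a) := by
    rw [eq_div_iff (by positivity)]
    linarith
  rw [← geom m le_rfl, ← hu]
  linarith

/-- If `U ε` solves the regularized extended-domain system for every `ε > 0`,
then `ε·U ε N → (w·uold)/(τ·w + γ)` as `ε → 0⁺`; in particular, if `uold > 0`
then `U ε N → +∞` as `ε → 0⁺`: the value on the cell beyond the new interface
diverges in the regularization limit. -/
theorem regularized_system_last_cell_diverges
    (N : ℕ) (hN : 5 ≤ N) (w τ γ uold : ℝ)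
    (hw : 0 < w) (hτ : 0 < τ) (hγ : 0 < γ)
    (U : ℝ → ℕ → ℝ)
    (hU : ∀ ε : ℝ, 0 < ε → RegularizedSystem N w τ γ uold ε (U ε)) :
    Tendsto (fun ε : ℝ => ε * U ε N) (nhdsWithin 0 (Set.Ioi 0))
      (nhds (w * uold / (τ * w + γ))) ∧
    (0 < uold →
      Tendsto (fun ε : ℝ => U ε N) (nhdsWithin 0 (Set.Ioi 0)) atTop) := by
  obtain ⟨m, rfl⟩ : ∃ m, N = m + 4 := ⟨N - 4, by omega⟩
  have ha : 0 < w / γ := div_pos hw hγ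
  have lim : Tendsto (fun ε : ℝ => ε * U ε (m + 4)) (nhdsWithin 0 (Set.Ioi 0))
      (nhds (w * uold / (τ * w + γ))) := by
    have hc : ContinuousAt (fun ε : ℝ => w / γ * (w / γ * ((w / γ / (ε + w / γ)) ^ m *
        (uold / τ / (ε + w / γ))) / (ε + 1 / τ + w / γ))) 0 := by
      have h₁ : (0 : ℝ) + w / γ ≠ 0 := by positivity
      have h₂ : (0 : ℝ) + 1 / τ + w / γ ≠ 0 := by positivity
      fun_prop (disch := assumption)
    have hv : w / γ * (w / γ * ((w / γ / (0 + w / γ)) ^ m *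
        (uold / τ / (0 + w / γ))) / (0 + 1 / τ + w / γ)) = w * uold / (τ * w + γ) := by
      rw [zero_add, zero_add, div_self ha.ne', one_pow]
      field_simp
      ring
    rw [← hv]
    refine (hc.tendsto.mono_left nhdsWithin_le_nhds).congr' ?_
    filter_upwards [self_mem_nhdsWithin] with ε hε
    exact ((hU ε hε).mul_last_eq hw hτ hγ hε).symm
  refine ⟨lim, fun h => ?_⟩
  refine (tendsto_inv_nhdsGT_zero.atTop_mul_pos (by positivity) lim).congr' ?_
  filter_upwards [self_mem_nhdsWithin] with ε hε
  exact inv_mul_cancel_left₀ (ne_of_gt hε) _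
end

section
/- In the regularization limit of the extended-domain system, the discrete solution value at the new interface, namely L := lim_{ε→0⁺} u_{N−1}(ε) = (γ/(τ·w + γ))·u_old, fails to satisfy mass conservation whenever u_old ≠ 0: one has L ≠ u_old, and if u_old > 0 then L < u_old. In the special case γ = τ·w, the limit value is exactly L = u_old/2. -/
open Filter

/-- Solving the first `k + 1` interior equations by forward substitution. -/
theorem RegularizedSystem.eq_geometric {N : ℕ} {w τ γ uold ε : ℝ} {u : ℕ → ℝ}
    (h : RegularizedSystem N w τ γ uold ε u) (hε : ε + w / γ ≠ 0) (k : ℕ) (hk : k + 4 ≤ N) :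
    u (k + 2) = (w / γ / (ε + w / γ)) ^ k * (uold / τ / (ε + w / γ)) := by
  obtain ⟨-, h2, hj, -, -⟩ := h
  induction k with
  | zero =>
    rw [pow_zero, one_mul, eq_div_iff hε]
    linear_combination h2
  | succ k ih =>
    have hstep := hj (k + 3) (by omega) (by omega)
    rw [show k + 3 - 1 = k + 2 by omega] at hstep
    rw [pow_succ', mul_assoc, ← ih (by omega), show k + 1 + 2 = k + 3 by omega,
      div_mul_eq_mul_div, eq_div_iff hε]
    linear_combination hstep

/-- The explicit value of the solution in the new interface cell. -/
theorem RegularizedSystem.interface_eq {N : ℕ} {w τ γ uold ε : ℝ} {u : ℕ → ℝ}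
    (h : RegularizedSystem N w τ γ uold ε u) (hN : 4 ≤ N) (hε : ε + w / γ ≠ 0)
    (hετ : ε + 1 / τ + w / γ ≠ 0) :
    u (N - 1) = w / γ * ((w / γ / (ε + w / γ)) ^ (N - 4) * (uold / τ / (ε + w / γ))) /
      (ε + 1 / τ + w / γ) := by
  have hu := h.eq_geometric hε (N - 4) (by omega)
  rw [show N - 4 + 2 = N - 2 by omega] at hu
  rw [← hu, eq_div_iff hετ]
  linear_combination h.2.2.2.1

/-- In the regularization limit, the discrete value at the new interface,
`L = lim_{ε→0⁺} U ε (N−1) = (γ/(τ·w + γ))·uold`, fails mass conservation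
whenever `uold ≠ 0`: `L ≠ uold`, and `L < uold` if `uold > 0`.
In the special case `γ = τ·w`, the limit value is exactly `L = uold/2`. -/
theorem regularized_system_mass_conservation_failure
    (N : ℕ) (hN : 5 ≤ N) (w τ γ uold : ℝ)
    (hw : 0 < w) (hτ : 0 < τ) (hγ : 0 < γ)
    (U : ℝ → ℕ → ℝ)
    (hU : ∀ ε : ℝ, 0 < ε → RegularizedSystem N w τ γ uold ε (U ε)) :
    Tendsto (fun ε : ℝ => U ε (N - 1)) (nhdsWithin 0 (Set.Ioi 0))
      (nhds ((γ / (τ * w + γ)) * uold)) ∧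
    (uold ≠ 0 → (γ / (τ * w + γ)) * uold ≠ uold) ∧
    (0 < uold → (γ / (τ * w + γ)) * uold < uold) ∧
    (γ = τ * w → (γ / (τ * w + γ)) * uold = uold / 2) := by
  have hsum : 0 < τ * w + γ := by positivity
  have hlt : γ / (τ * w + γ) < 1 := by
    rw [div_lt_one hsum]
    linarith [mul_pos hτ hw]
  refine ⟨?_, fun h0 h => hlt.ne (mul_right_cancel₀ h0 (h.trans (one_mul uold).symm)),
    fun h0 => mul_lt_of_lt_one_left h0 hlt, fun h => ?_⟩
  · have ha : 0 < w / γ := div_pos hw hγ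
    have hb : 0 < 1 / τ + w / γ := by positivity
    have hcont : ContinuousAt (fun ε : ℝ =>
        w / γ * ((w / γ / (ε + w / γ)) ^ (N - 4) * (uold / τ / (ε + w / γ))) /
          (ε + 1 / τ + w / γ)) 0 := by
      fun_prop (disch := simp only [zero_add]; positivity)
    have hlim : w / γ * ((w / γ / (0 + w / γ)) ^ (N - 4) * (uold / τ / (0 + w / γ))) /
        (0 + 1 / τ + w / γ) = γ / (τ * w + γ) * uold := by
      rw [zero_add, zero_add, div_self ha.ne', one_pow, one_mul, mul_div_cancel₀ _ ha.ne']
      field_simp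
      ring
    have ht := hcont.tendsto.mono_left (nhdsWithin_le_nhds (s := Set.Ioi 0))
    rw [hlim] at ht
    refine ht.congr' ?_
    filter_upwards [self_mem_nhdsWithin] with ε hε
    have hε : 0 < ε := hε
    exact ((hU ε hε).interface_eq (by omega) (by positivity) (by positivity)).symm
  · rw [← h]
    field_simp
    ring
end
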